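/- Suppose the pair predictor p̂₂ is pair-calibrated with grouping function Φ. Then for every x ∈ 𝒳 and y ∈ 𝒴: C(y|x) = 1 if and only if p̂₁(y|x) > 0 and p(y|x') = p̂₁(y|x) for every x' ∈ [x]_Φ (so that in particular p̂₁(y|x) = p(y|x)). -/

import Mathlib

open Finset

open scoped Classical

/-- Conditional expectation of `f(X)` given `X ∈ [x]_Φ`, where `X ∼ μ` on a finite set. -/
noncomputable def groupExp {𝒳 𝒵 : Type*} [Fintype 𝒳] (μ : 𝒳 → ℝ) (Φ : 𝒳 → 𝒵)
    (f : 𝒳 → ℝ) (x : 𝒳) : ℝ :=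
  (∑ x' : 𝒳, if Φ x' = Φ x then μ x' * f x' else 0) /
  (∑ x' : 𝒳, if Φ x' = Φ x then μ x' else 0)

/-- Marginal `p̂₁(y|x) = ∑_{y'} p̂₂(y,y'|x)` of a pair predictor. -/
noncomputable def marginal {𝒳 𝒴 : Type*} [Fintype 𝒴] (p2 : 𝒳 → 𝒴 → 𝒴 → ℝ) (x : 𝒳) (y : 𝒴) : ℝ :=
  ∑ y' : 𝒴, p2 x y y'

/-- Cheat-corrected epistemic variance `V̂(y|x) = p̂₂(y,y|x) − p̂₁(y|x)²`. -/
noncomputable def cheatVar {𝒳 𝒴 : Type*} [Fintype 𝒴] (p2 : 𝒳 → 𝒴 → 𝒴 → ℝ) (x : 𝒳) (y : 𝒴) : ℝ :=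
  p2 x y y - (marginal p2 x y) ^ 2

/-- Cheat-corrected epistemic confidence `C(y|x)`. -/
noncomputable def cheatConf {𝒳 𝒴 : Type*} [Fintype 𝒴] (p2 : 𝒳 → 𝒴 → 𝒴 → ℝ) (x : 𝒳) (y : 𝒴) : ℝ :=
  if 0 < p2 x y y then (marginal p2 x y) ^ 2 / p2 x y y else 0


/-- Every equivalence class has positive mass. -/
lemma class_mass_pos {𝒳 𝒵 : Type*} [Fintype 𝒳] {μ : 𝒳 → ℝ} (hμ : ∀ x, 0 < μ x)
    (Φ : 𝒳 → 𝒵) (x : 𝒳) : 0 < ∑ x' : 𝒳, if Φ x' = Φ x then μ x' else 0 := by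
  refine Finset.sum_pos' (fun i _ => ?_) ⟨x, mem_univ x, by simpa using hμ x⟩
  split_ifs
  exacts [(hμ i).le, le_rfl]

/-- The marginal of a pair-calibrated predictor is the conditional expectation of the truth. -/
lemma marginal_eq_groupExp {𝒳 𝒴 𝒵 : Type*} [Fintype 𝒳] [Fintype 𝒴] {μ : 𝒳 → ℝ}
    {p : 𝒳 → 𝒴 → ℝ} (hp1 : ∀ x, ∑ y, p x y = 1) {p2 : 𝒳 → 𝒴 → 𝒴 → ℝ} {Φ : 𝒳 → 𝒵}
    (hcal : ∀ x y₁ y₂, p2 x y₁ y₂ = groupExp μ Φ (fun x' => p x' y₁ * p x' y₂) x)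
    (x : 𝒳) (y : 𝒴) : marginal p2 x y = groupExp μ Φ (fun x' => p x' y) x := by
  simp only [marginal, hcal, groupExp]
  rw [← Finset.sum_div, Finset.sum_comm]
  congr 1
  refine Finset.sum_congr rfl fun x' _ => ?_
  split_ifs
  · rw [← Finset.mul_sum, ← Finset.mul_sum, hp1, mul_one]
  · simp

/-- The conditional expectation of a function that is constant on the class. -/
lemma groupExp_of_eq_const {𝒳 𝒵 : Type*} [Fintype 𝒳] {μ : 𝒳 → ℝ} (hμ : ∀ x, 0 < μ x)
    {Φ : 𝒳 → 𝒵} {f : 𝒳 → ℝ} {x : 𝒳} {c : ℝ} (hf : ∀ x', Φ x' = Φ x → f x' = c) :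
    groupExp μ Φ f x = c := by
  rw [groupExp, div_eq_iff (class_mass_pos hμ Φ x).ne', Finset.mul_sum]
  refine Finset.sum_congr rfl fun x' _ => ?_
  split_ifs with h
  · rw [hf x' h, mul_comm]
  · simp

/-- A function whose conditional second moment is the square of its conditional mean is
constant on the class. -/
lemma eq_groupExp_of_sq_eq {𝒳 𝒵 : Type*} [Fintype 𝒳] {μ : 𝒳 → ℝ} (hμ : ∀ x, 0 < μ x)
    {Φ : 𝒳 → 𝒵} {f : 𝒳 → ℝ} {x : 𝒳}
    (h : groupExp μ Φ f x ^ 2 = groupExp μ Φ (fun x' => f x' * f x') x)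
    {x' : 𝒳} (hx' : Φ x' = Φ x) : f x' = groupExp μ Φ f x := by
  have hW := (class_mass_pos hμ Φ x).ne'
  set m := groupExp μ Φ f x with hm
  have h1 := (div_eq_iff hW).1 hm.symm
  have h2 := (div_eq_iff hW).1 h.symm
  have hsum : ∑ i : 𝒳, (if Φ i = Φ x then μ i * (f i - m) ^ 2 else 0) = 0 := by
    have hexp : ∑ i : 𝒳, (if Φ i = Φ x then μ i * (f i - m) ^ 2 else 0) =
        (∑ i : 𝒳, if Φ i = Φ x then μ i * (f i * f i) else 0)
          - 2 * m * (∑ i : 𝒳, if Φ i = Φ x then μ i * f i else 0)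
          + m ^ 2 * ∑ i : 𝒳, if Φ i = Φ x then μ i else 0 := by
      rw [Finset.mul_sum, Finset.mul_sum, ← Finset.sum_sub_distrib, ← Finset.sum_add_distrib]
      refine Finset.sum_congr rfl fun i _ => ?_
      split_ifs <;> ring
    rw [hexp, h1, h2]
    ring
  have hnonneg : ∀ i ∈ (univ : Finset 𝒳),
      0 ≤ if Φ i = Φ x then μ i * (f i - m) ^ 2 else 0 := by
    intro i _
    split_ifs
    exacts [mul_nonneg (hμ i).le (sq_nonneg _), le_rfl]
  have hzero := (Finset.sum_eq_zero_iff_of_nonneg hnonneg).1 hsum x' (mem_univ x')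
  rw [if_pos hx'] at hzero
  exact sub_eq_zero.1 (pow_eq_zero_iff two_ne_zero |>.1
    ((mul_eq_zero.1 hzero).resolve_left (hμ x').ne'))

/-- The cheat-corrected epistemic confidence equals 1 iff the marginal
prediction is positive and the true conditional probability is constant, equal to the
marginal prediction, on the whole equivalence class. -/
theorem stmt_10 {𝒳 𝒴 𝒵 : Type*} [Fintype 𝒳] [Fintype 𝒴] [Nonempty 𝒳] [Nonempty 𝒴]
    (μ : 𝒳 → ℝ) (hμpos : ∀ x, 0 < μ x) (hμsum : ∑ x, μ x = 1)
    (p : 𝒳 → 𝒴 → ℝ) (hp0 : ∀ x y, 0 ≤ p x y) (hp1 : ∀ x, ∑ y, p x y = 1)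
    (p2 : 𝒳 → 𝒴 → 𝒴 → ℝ)
    (hp20 : ∀ x y₁ y₂, 0 ≤ p2 x y₁ y₂) (hp21 : ∀ x, ∑ y₁, ∑ y₂, p2 x y₁ y₂ = 1)
    (Φ : 𝒳 → 𝒵)
    (hcal : ∀ x y₁ y₂, p2 x y₁ y₂ = groupExp μ Φ (fun x' => p x' y₁ * p x' y₂) x) :
    ∀ x y, cheatConf p2 x y = 1 ↔
      (0 < marginal p2 x y ∧ ∀ x', Φ x' = Φ x → p x' y = marginal p2 x y) := by
  intro x y
  have hmarg := marginal_eq_groupExp hp1 hcal x y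
  constructor
  · intro hC
    unfold cheatConf at hC
    split_ifs at hC with hpos
    · rw [div_eq_one_iff_eq hpos.ne'] at hC
      have hm0 : 0 ≤ marginal p2 x y := Finset.sum_nonneg fun y' _ => hp20 x y y'
      refine ⟨lt_of_le_of_ne hm0 fun h0 => ?_, fun x' hx' => ?_⟩
      · rw [← hC, ← h0] at hpos
        simp at hpos
      · rw [hmarg, hcal] at hC
        rw [hmarg]
        exact eq_groupExp_of_sq_eq (f := fun x' => p x' y) hμpos hC hx'
    · exact absurd hC zero_ne_one
  · rintro ⟨hpos, hconst⟩
    have hdiag : p2 x y y = marginal p2 x y ^ 2 := by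
      rw [hcal]
      exact groupExp_of_eq_const hμpos fun x' hx' => by rw [hconst x' hx', sq]
    have hsq : 0 < marginal p2 x y ^ 2 := pow_pos hpos 2
    rw [cheatConf, hdiag, if_pos hsq, div_self hsq.ne']
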